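/- For every dominant λ ∈ Λ there exists a unique W-invariant element a_λ ∈ ℂ[Λ]^W such that alt(e^ρ)·a_λ = alt(e^{λ+ρ}) in ℂ[Λ] (i.e. alt(e^ρ) divides alt(e^{λ+ρ}) with W-invariant quotient), and the family { a_λ : λ ∈ Λ dominant } is a ℂ-basis of ℂ[Λ]^W. -/

import Mathlib

noncomputable section

namespace CS

open scoped RealInnerProductSpace
open Finsupp

variable {V : Type} [NormedAddCommGroup V] [InnerProductSpace ℝ V] [FiniteDimensional ℝ V]

/-- The coroot pairing `⟨v, α^∨⟩ = 2⟪v,α⟫/⟪α,α⟫`. -/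
def pair (v α : V) : ℝ := 2 * ⟪v, α⟫ / ⟪α, α⟫

/-- A reduced crystallographic root system spanning `V`. -/
structure IsRootSystem (Φ : Set V) : Prop where
  finite : Φ.Finite
  ne_zero : (0 : V) ∉ Φ
  span_top : Submodule.span ℝ Φ = ⊤
  reflect_mem : ∀ α ∈ Φ, ∀ β ∈ Φ, β - pair β α • α ∈ Φ
  crystallographic : ∀ α ∈ Φ, ∀ β ∈ Φ, ∃ k : ℤ, pair β α = k
  reduced : ∀ α ∈ Φ, ∀ c : ℝ, c • α ∈ Φ → c = 1 ∨ c = -1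

/-- `P` is a system of positive roots for `Φ`. -/
def IsPositiveSystem (Φ P : Set V) : Prop :=
  P ⊆ Φ ∧ (∀ α ∈ Φ, (α ∈ P ∨ -α ∈ P) ∧ ¬(α ∈ P ∧ -α ∈ P)) ∧
    (∀ α ∈ P, ∀ β ∈ P, α + β ∈ Φ → α + β ∈ P)

/-- The simple roots: indecomposable positive roots. -/
def simpleRoots (P : Set V) : Set V := {α ∈ P | ¬∃ β ∈ P, ∃ γ ∈ P, α = β + γ}

/-- Half the sum of the positive roots. -/
def rho (P : Set V) : V := (2 : ℝ)⁻¹ • ∑ᶠ α ∈ P, α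

/-- The weight lattice `Λ`. -/
def weightLattice (Φ : Set V) : AddSubgroup V where
  carrier := {v | ∀ α ∈ Φ, ∃ k : ℤ, pair v α = k}
  zero_mem' := fun α _ => ⟨0, by simp [pair]⟩
  add_mem' := by
    rintro a b ha hb α hα
    obtain ⟨k, hk⟩ := ha α hα
    obtain ⟨l, hl⟩ := hb α hα
    refine ⟨k + l, ?_⟩
    push_cast
    rw [← hk, ← hl]
    simp only [pair, inner_add_left]
    ring
  neg_mem' := by
    rintro a ha α hα
    obtain ⟨k, hk⟩ := ha α hα
    refine ⟨-k, ?_⟩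
    push_cast
    rw [← hk]
    simp only [pair, inner_neg_left]
    ring

/-- The Weyl group: the subgroup generated by the reflections in the roots. -/
def weylGroup (Φ : Set V) : Subgroup (V ≃ₗ[ℝ] V) :=
  Subgroup.closure {s | ∃ α ∈ Φ, ∀ v, s v = v - pair v α • α}

/-- The sign character `ε(w) = det w`, as a complex number. -/
def sgn (w : V ≃ₗ[ℝ] V) : ℂ := ((LinearMap.det (w : V →ₗ[ℝ] V) : ℝ) : ℂ)

section stability

variable {Φ : Set V}

lemma sα_inner (hΦ : IsRootSystem Φ) {α : V} (hα : α ∈ Φ) (v β : V) :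
    ⟪v - pair v α • α, β⟫ = ⟪v, β - pair β α • α⟫ := by
  simp only [pair, inner_sub_left, inner_sub_right, real_inner_smul_left,
    real_inner_smul_right]
  rw [real_inner_comm α β]
  ring

lemma sα_norm (hΦ : IsRootSystem Φ) {α : V} (hα : α ∈ Φ) (β : V) :
    ⟪β - pair β α • α, β - pair β α • α⟫ = ⟪β, β⟫ := by
  have hα0 : α ≠ 0 := fun h => hΦ.ne_zero (h ▸ hα)
  have hne : ⟪α, α⟫ ≠ 0 := (inner_self_ne_zero (𝕜 := ℝ)).mpr hα0
  simp only [pair, inner_sub_left, inner_sub_right, real_inner_smul_left,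
    real_inner_smul_right]
  rw [real_inner_comm α β]
  field_simp
  ring

lemma sα_mem_lattice (hΦ : IsRootSystem Φ) {α : V} (hα : α ∈ Φ)
    {v : V} (hv : v ∈ weightLattice Φ) : v - pair v α • α ∈ weightLattice Φ := by
  intro β hβ
  obtain ⟨k, hk⟩ := hv _ (hΦ.reflect_mem α hα β hβ)
  refine ⟨k, ?_⟩
  rw [← hk]
  have h1 := sα_inner hΦ hα v β
  have h2 := sα_norm hΦ hα β
  simp only [pair] at h1 h2 ⊢
  rw [h1, h2]

end stability

end CS

namespace CS

open scoped RealInnerProductSpace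

variable {V : Type} [NormedAddCommGroup V] [InnerProductSpace ℝ V] [FiniteDimensional ℝ V]
variable {Φ : Set V}

lemma sα_invol (hΦ : IsRootSystem Φ) {α : V} (hα : α ∈ Φ) {s : V ≃ₗ[ℝ] V}
    (hs : ∀ v, s v = v - pair v α • α) (v : V) : s (s v) = v := by
  have hα0 : α ≠ 0 := fun h => hΦ.ne_zero (h ▸ hα)
  have hne : ⟪α, α⟫ ≠ 0 := (inner_self_ne_zero (𝕜 := ℝ)).mpr hα0
  have hpair : pair (v - pair v α • α) α = -pair v α := by
    simp only [pair, inner_sub_left, real_inner_smul_left]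
    field_simp
    ring
  rw [hs, hs, hpair]
  module

lemma weyl_stable (hΦ : IsRootSystem Φ) {w : V ≃ₗ[ℝ] V} (hw : w ∈ weylGroup Φ)
    {v : V} (hv : v ∈ weightLattice Φ) : w v ∈ weightLattice Φ := by
  revert v
  suffices h : (∀ v ∈ weightLattice Φ, w v ∈ weightLattice Φ) ∧
      (∀ v ∈ weightLattice Φ, w⁻¹ v ∈ weightLattice Φ) from fun v hv => h.1 v hv
  induction hw using Subgroup.closure_induction with
  | mem s hs =>
    obtain ⟨α, hα, hsα⟩ := hs
    have h1 : ∀ v ∈ weightLattice Φ, s v ∈ weightLattice Φ := by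
      intro v hv
      rw [hsα]
      exact sα_mem_lattice hΦ hα hv
    refine ⟨h1, ?_⟩
    have hss : s * s = 1 := by
      apply LinearEquiv.toLinearMap_injective
      apply LinearMap.ext
      intro v
      simpa using sα_invol hΦ hα hsα v
    have hinv : s⁻¹ = s := inv_eq_of_mul_eq_one_right hss
    rw [hinv]
    exact h1
  | one =>
    constructor <;> (intro v hv; simpa using hv)
  | mul a b _ _ pa pb =>
    constructor
    · intro v hv
      have : (a * b) v = a (b v) := rfl
      rw [this]
      exact pa.1 _ (pb.1 v hv)
    · intro v hv
      have : (a * b)⁻¹ v = b⁻¹ (a⁻¹ v) := by rw [mul_inv_rev]; rfl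
      rw [this]
      exact pb.2 _ (pa.2 v hv)
  | inv a _ pa =>
    refine ⟨pa.2, ?_⟩
    intro v hv
    rw [inv_inv]
    exact pa.1 v hv

/-- The group algebra `ℂ[Λ]`. -/
abbrev GA (Φ : Set V) := AddMonoidAlgebra ℂ ↥(weightLattice Φ)

/-- `e^μ`, the basis element of `ℂ[Λ]` attached to `μ ∈ Λ`. -/
def e (μ : ↥(weightLattice Φ)) : GA Φ := AddMonoidAlgebra.single μ 1

/-- The action of `w ∈ W` on the lattice `Λ`. -/
def latHom (hΦ : IsRootSystem Φ) {w : V ≃ₗ[ℝ] V} (hw : w ∈ weylGroup Φ) :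
    weightLattice Φ →+ weightLattice Φ where
  toFun x := ⟨w x, weyl_stable hΦ hw x.2⟩
  map_zero' := by ext; simp
  map_add' x y := by ext; simp

/-- The action of `w ∈ W` on the group algebra `ℂ[Λ]`. -/
def act (hΦ : IsRootSystem Φ) {w : V ≃ₗ[ℝ] V} (hw : w ∈ weylGroup Φ) :
    GA Φ →ₐ[ℂ] GA Φ :=
  AddMonoidAlgebra.mapDomainAlgHom ℂ ℂ (latHom hΦ hw)

/-- The alternation map `alt f = ∑_{w ∈ W} ε(w) • (w · f)`. -/
def alt (hΦ : IsRootSystem Φ) (f : GA Φ) : GA Φ :=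
  ∑ᶠ w : ↥(weylGroup Φ), sgn (w : V ≃ₗ[ℝ] V) • act hΦ w.2 f

/-- `W`-invariant elements of `ℂ[Λ]`, i.e. members of `ℂ[Λ]^W`. -/
def IsInvariant (hΦ : IsRootSystem Φ) (a : GA Φ) : Prop :=
  ∀ (w : V ≃ₗ[ℝ] V) (hw : w ∈ weylGroup Φ), act hΦ hw a = a

/-- `W`-skew-invariant elements of `ℂ[Λ]`, i.e. members of `ℂ[Λ]^{W,-}`. -/
def IsSkewInvariant (hΦ : IsRootSystem Φ) (f : GA Φ) : Prop :=
  ∀ (w : V ≃ₗ[ℝ] V) (hw : w ∈ weylGroup Φ), act hΦ hw f = sgn w • f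

/-- `ℂ[Λ]^{W,-}` as a complex subspace of `ℂ[Λ]`. -/
def skewSubmodule (hΦ : IsRootSystem Φ) : Submodule ℂ (GA Φ) where
  carrier := {f | IsSkewInvariant hΦ f}
  add_mem' := by
    intro a b ha hb w hw
    rw [map_add, ha w hw, hb w hw, smul_add]
  zero_mem' := by
    intro w hw
    rw [map_zero, smul_zero]
  smul_mem' := by
    intro c f hf w hw
    rw [map_smul, hf w hw, smul_comm]

/-- `ℂ[Λ]^W` as a subalgebra of `ℂ[Λ]`. -/
def invSubalgebra (hΦ : IsRootSystem Φ) : Subalgebra ℂ (GA Φ) where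
  carrier := {a | IsInvariant hΦ a}
  mul_mem' := by
    intro a b ha hb w hw
    rw [map_mul, ha w hw, hb w hw]
  one_mem' := by
    intro w hw
    rw [map_one]
  add_mem' := by
    intro a b ha hb w hw
    rw [map_add, ha w hw, hb w hw]
  zero_mem' := by
    intro w hw
    rw [map_zero]
  algebraMap_mem' := by
    intro c w hw
    exact (act hΦ hw).commutes c

/-- `ℂ[Λ]^{W,-}` as a module over `ℂ[Λ]^W`. -/
def skewSubmoduleW (hΦ : IsRootSystem Φ) : Submodule ↥(invSubalgebra hΦ) (GA Φ) where
  carrier := {f | IsSkewInvariant hΦ f}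
  add_mem' := by
    intro a b ha hb w hw
    rw [map_add, ha w hw, hb w hw, smul_add]
  zero_mem' := by
    intro w hw
    rw [map_zero, smul_zero]
  smul_mem' := by
    intro c f hf w hw
    rw [Subalgebra.smul_def, smul_eq_mul, map_mul, c.2 w hw, hf w hw, mul_smul_comm]

/-- The generators `e^μ - ε(w)·e^{wμ}` of the kernel of `alt`. -/
def kerGens (hΦ : IsRootSystem Φ) : Set (GA Φ) :=
  {x | ∃ (μ : ↥(weightLattice Φ)) (w : V ≃ₗ[ℝ] V) (hw : w ∈ weylGroup Φ),
    x = e μ - sgn w • e (latHom hΦ hw μ)}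

end CS

namespace CS

open scoped RealInnerProductSpace Pointwise

variable {V : Type} [NormedAddCommGroup V] [InnerProductSpace ℝ V]
variable {Φ P : Set V}

section reflections

lemma pair_sub_left (x y α : V) : pair (x - y) α = pair x α - pair y α := by
  simp only [pair, inner_sub_left]
  ring

lemma pair_smul_left (c : ℝ) (x α : V) : pair (c • x) α = c * pair x α := by
  simp only [pair, real_inner_smul_left]
  ring

lemma pair_self {α : V} (hα : α ≠ 0) : pair α α = 2 := by
  have : ⟪α, α⟫ ≠ 0 := (inner_self_ne_zero (𝕜 := ℝ)).mpr hα
  simp only [pair]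
  field_simp

lemma pair_mul_inner_self (v α : V) : pair v α * ⟪α, α⟫ = 2 * ⟪v, α⟫ := by
  rcases eq_or_ne α 0 with rfl | hα
  · simp
  have : ⟪α, α⟫ ≠ 0 := (inner_self_ne_zero (𝕜 := ℝ)).mpr hα
  simp only [pair]
  field_simp

lemma inner_self_pos_of_ne_zero {α : V} (hα : α ≠ 0) : 0 < ⟪α, α⟫ :=
  real_inner_self_pos.mpr hα

lemma pair_pos_iff {v α : V} (hα : α ≠ 0) : 0 < pair v α ↔ 0 < ⟪v, α⟫ := by
  have := inner_self_pos_of_ne_zero hα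
  rw [← mul_pos_iff_of_pos_right this, pair_mul_inner_self]
  constructor <;> intro h <;> linarith

lemma pair_nonneg_iff {v α : V} (hα : α ≠ 0) : 0 ≤ pair v α ↔ 0 ≤ ⟪v, α⟫ := by
  have := inner_self_pos_of_ne_zero hα
  rw [← mul_nonneg_iff_of_pos_right this, pair_mul_inner_self]
  constructor <;> intro h <;> linarith

/-- The linear form `v ↦ ⟨v, α^∨⟩`. -/
def pairForm (α : V) : Module.Dual ℝ V where
  toFun v := pair v α
  map_add' x y := by
    simp only [pair, inner_add_left]
    ring
  map_smul' c x := pair_smul_left c x α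

/-- The reflection in the hyperplane orthogonal to `α`. -/
def refl (α : V) : V ≃ₗ[ℝ] V :=
  LinearEquiv.ofInvolutive (LinearMap.transvection (-pairForm α) α) fun v => by
    have h (x : V) : LinearMap.transvection (-pairForm α) α x = x - pair x α • α := by
      simp [LinearMap.transvection.apply, pairForm, sub_eq_add_neg]
    rcases eq_or_ne α 0 with rfl | hα
    · simp
    · rw [h, h, pair_sub_left, pair_smul_left, pair_self hα]
      module

lemma refl_apply (α v : V) : refl α v = v - pair v α • α := by
  simp [refl, LinearMap.transvection.apply, pairForm, sub_eq_add_neg]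

lemma refl_refl (α v : V) : refl α (refl α v) = v :=
  (refl α).left_inv v

lemma refl_mul_self (α : V) : refl α * refl α = 1 :=
  LinearEquiv.ext (refl_refl α)

lemma refl_inv (α : V) : (refl α)⁻¹ = refl α :=
  inv_eq_of_mul_eq_one_right (refl_mul_self α)

lemma refl_self {α : V} (hα : α ≠ 0) : refl α α = -α := by
  rw [refl_apply, pair_self hα]
  module

lemma refl_eq_self {α v : V} (h : pair v α = 0) : refl α v = v := by
  rw [refl_apply, h, zero_smul, sub_zero]

lemma inner_refl_refl (α x y : V) : ⟪refl α x, refl α y⟫ = ⟪x, y⟫ := by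
  have hx := pair_mul_inner_self x α
  have hy := pair_mul_inner_self y α
  simp only [refl_apply, inner_sub_left, inner_sub_right, real_inner_smul_left,
    real_inner_smul_right, real_inner_comm y α] at hx hy ⊢
  linear_combination (1 / 2) * pair x α * hy + (1 / 2) * pair y α * hx

lemma sgn_refl [FiniteDimensional ℝ V] {α : V} (hα : α ≠ 0) : sgn (refl α) = -1 := by
  have h : ((refl α : V ≃ₗ[ℝ] V) : V →ₗ[ℝ] V) = LinearMap.transvection (-pairForm α) α := rfl
  have h2 : (-pairForm α) α = -2 := by
    simpa [pairForm] using pair_self hα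
  rw [sgn, h, LinearMap.transvection.det, h2]
  norm_num

end reflections

section weyl

lemma refl_mem_weylGroup {α : V} (hα : α ∈ Φ) : refl α ∈ weylGroup Φ :=
  Subgroup.subset_closure ⟨α, hα, refl_apply α⟩

lemma eq_refl_of_forall {s : V ≃ₗ[ℝ] V} {α : V} (h : ∀ v, s v = v - pair v α • α) : s = refl α :=
  LinearEquiv.ext fun v => by rw [h, refl_apply]

lemma inner_weyl {w : V ≃ₗ[ℝ] V} (hw : w ∈ weylGroup Φ) : ∀ x y, ⟪w x, w y⟫ = ⟪x, y⟫ := by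
  induction hw using Subgroup.closure_induction with
  | mem s hs =>
    obtain ⟨α, -, h⟩ := hs
    rw [eq_refl_of_forall h]
    exact inner_refl_refl α
  | one => exact fun _ _ => rfl
  | mul a b _ _ ha hb => exact fun x y => (ha _ _).trans (hb _ _)
  | inv a _ ha =>
    intro x y
    rw [← ha, ← LinearEquiv.mul_apply, ← LinearEquiv.mul_apply, mul_inv_cancel]
    rfl

lemma norm_weyl {w : V ≃ₗ[ℝ] V} (hw : w ∈ weylGroup Φ) (x : V) : ‖w x‖ = ‖x‖ := by
  rw [norm_eq_sqrt_real_inner, inner_weyl hw, ← norm_eq_sqrt_real_inner]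

lemma pair_weyl {w : V ≃ₗ[ℝ] V} (hw : w ∈ weylGroup Φ) (x y : V) :
    pair (w x) (w y) = pair x y := by
  simp only [pair, inner_weyl hw]

lemma refl_weyl {w : V ≃ₗ[ℝ] V} (hw : w ∈ weylGroup Φ) (α : V) :
    refl (w α) = w * refl α * w⁻¹ := by
  refine LinearEquiv.ext fun v => ?_
  obtain ⟨u, rfl⟩ := w.surjective v
  have h : w⁻¹ (w u) = u := w.symm_apply_apply u
  simp only [LinearEquiv.mul_apply, h, refl_apply, pair_weyl hw, map_sub, map_smul]

lemma refl_mem_root (hΦ : IsRootSystem Φ) {α β : V} (hα : α ∈ Φ) (hβ : β ∈ Φ) :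
    refl α β ∈ Φ := by
  rw [refl_apply]
  exact hΦ.reflect_mem α hα β hβ

lemma root_ne_zero (hΦ : IsRootSystem Φ) {α : V} (hα : α ∈ Φ) : α ≠ 0 :=
  fun h => hΦ.ne_zero (h ▸ hα)

lemma neg_mem_root (hΦ : IsRootSystem Φ) {α : V} (hα : α ∈ Φ) : -α ∈ Φ :=
  refl_self (root_ne_zero hΦ hα) ▸ refl_mem_root hΦ hα hα

lemma weyl_mem_root_iff (hΦ : IsRootSystem Φ) {w : V ≃ₗ[ℝ] V} (hw : w ∈ weylGroup Φ) :
    ∀ β, w β ∈ Φ ↔ β ∈ Φ := by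
  induction hw using Subgroup.closure_induction with
  | mem s hs =>
    obtain ⟨α, hα, h⟩ := hs
    rw [eq_refl_of_forall h]
    exact fun β => ⟨fun hβ => refl_refl α β ▸ refl_mem_root hΦ hα hβ, refl_mem_root hΦ hα⟩
  | one => exact fun _ => Iff.rfl
  | mul a b _ _ ha hb => exact fun β => (ha _).trans (hb _)
  | inv a _ ha =>
    intro β
    rw [← ha, ← LinearEquiv.mul_apply, mul_inv_cancel]
    rfl

lemma finite_weylGroup (hΦ : IsRootSystem Φ) : Finite (weylGroup Φ) := by
  have := hΦ.finite.to_subtype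
  refine Finite.of_injective
    (fun (w : weylGroup Φ) (β : Φ) => (⟨w.1 β, (weyl_mem_root_iff hΦ w.2 β).2 β.2⟩ : Φ)) ?_
  intro u w h
  apply Subtype.ext
  apply LinearEquiv.toLinearMap_injective
  refine LinearMap.ext_on hΦ.span_top fun β hβ => ?_
  exact congrArg Subtype.val (congrFun h ⟨β, hβ⟩)

lemma sub_mem_root (hΦ : IsRootSystem Φ) {α β : V} (hα : α ∈ Φ) (hβ : β ∈ Φ)
    (hpos : 0 < ⟪α, β⟫) (hne : α ≠ β) : α - β ∈ Φ := by
  have hα0 := root_ne_zero hΦ hα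
  have hβ0 := root_ne_zero hΦ hβ
  obtain ⟨k, hk⟩ := hΦ.crystallographic β hβ α hα
  obtain ⟨l, hl⟩ := hΦ.crystallographic α hα β hβ
  have hk0 : 0 < k := by exact_mod_cast hk ▸ (pair_pos_iff hβ0).2 hpos
  have hl0 : 0 < l := by exact_mod_cast hl ▸ (pair_pos_iff hα0).2 (real_inner_comm α β ▸ hpos)
  by_cases hk1 : k = 1
  · simpa [hk, hk1] using hΦ.reflect_mem β hβ α hα
  by_cases hl1 : l = 1
  · simpa [hl, hl1] using neg_mem_root hΦ (hΦ.reflect_mem α hα β hβ)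
  have hk2 : (2 : ℝ) ≤ k := by exact_mod_cast (show 2 ≤ k by omega)
  have hl2 : (2 : ℝ) ≤ l := by exact_mod_cast (show 2 ≤ l by omega)
  have e1 := pair_mul_inner_self α β
  have e2 := pair_mul_inner_self β α
  rw [hk] at e1
  rw [hl, real_inner_comm α β] at e2
  have p1 := inner_self_pos_of_ne_zero hα0
  have p2 := inner_self_pos_of_ne_zero hβ0
  have hle : ⟪α - β, α - β⟫ ≤ 0 := by
    rw [real_inner_sub_sub_self]
    nlinarith
  by_contra
  exact hne (sub_eq_zero.1 (real_inner_self_nonpos.1 hle))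

end weyl
end CS

namespace CS

open scoped RealInnerProductSpace Pointwise

variable {V : Type} [NormedAddCommGroup V] [InnerProductSpace ℝ V]
variable {Φ P : Set V}

section positive

lemma neg_notMem_of_mem (hP : IsPositiveSystem Φ P) {α : V} (hα : α ∈ P) : -α ∉ P :=
  fun h => (hP.2.1 α (hP.1 hα)).2 ⟨hα, h⟩

lemma neg_mem_of_notMem (hP : IsPositiveSystem Φ P) {α : V} (hα : α ∈ Φ) (h : α ∉ P) : -α ∈ P :=
  (hP.2.1 α hα).1.resolve_left h

lemma multiset_sum_ne_zero (hΦ : IsRootSystem Φ) (hP : IsPositiveSystem Φ P) (n : ℕ) :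
    ∀ (α : V) (t : Multiset V), t.card = n → α ∈ P → (∀ x ∈ t, x ∈ P) → α + t.sum ≠ 0 := by
  induction n with
  | zero =>
    intro α t ht hα _ h
    rw [Multiset.card_eq_zero.1 ht, Multiset.sum_zero, add_zero] at h
    exact root_ne_zero hΦ (hP.1 hα) h
  | succ n ih =>
    intro α t ht hα hmem h
    have hα0 := root_ne_zero hΦ (hP.1 hα)
    have hneg : ∃ β ∈ t, ⟪α, β⟫ < 0 := by
      by_contra! hcon
      have h1 : 0 ≤ ⟪α, t.sum⟫ := by
        clear h hmem ht
        induction t using Multiset.induction with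
        | empty => simp
        | cons b u ihu =>
          rw [Multiset.sum_cons, inner_add_right]
          exact add_nonneg (hcon b (by simp)) (ihu fun β hβ => hcon β (by simp [hβ]))
      rw [eq_neg_of_add_eq_zero_right h, inner_neg_right] at h1
      linarith [inner_self_pos_of_ne_zero hα0]
    obtain ⟨β, hβ, hlt⟩ := hneg
    obtain ⟨u, rfl⟩ := Multiset.exists_cons_of_mem hβ
    have hβP := hmem β hβ
    have hroot : α + β ∈ Φ := by
      have := sub_mem_root hΦ (hP.1 hα) (neg_mem_root hΦ (hP.1 hβP))
        (by rw [inner_neg_right]; linarith)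
        (fun hc => neg_notMem_of_mem hP hβP (hc ▸ hα))
      simpa using this
    refine ih (α + β) u (by simpa using ht) (hP.2.2 α hα β hβP hroot)
      (fun x hx => hmem x (by simp [hx])) ?_
    rw [← h, Multiset.sum_cons, add_assoc]

lemma add_ne_zero_of_mem_closure (hΦ : IsRootSystem Φ) (hP : IsPositiveSystem Φ P) {α y : V}
    (hα : α ∈ P) (hy : y ∈ AddSubmonoid.closure P) : α + y ≠ 0 := by
  obtain ⟨t, ht, rfl⟩ := AddSubmonoid.exists_multiset_of_mem_closure hy
  exact multiset_sum_ne_zero hΦ hP _ α t rfl hα ht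

lemma mem_closure_simpleRoots (hΦ : IsRootSystem Φ) (hP : IsPositiveSystem Φ P) {β : V}
    (hβ : β ∈ P) : β ∈ AddSubmonoid.closure (simpleRoots P) := by
  let r : P → P → Prop := fun γ β => ∃ δ ∈ P, ∃ y ∈ AddSubmonoid.closure P, β.1 = γ + (δ + y)
  have : Finite P := (hΦ.finite.subset hP.1).to_subtype
  have : IsTrans P r := ⟨by
    rintro a b c ⟨d, hd, y, hy, h⟩ ⟨d', hd', y', hy', h'⟩
    exact ⟨d, hd, y + (d' + y'), add_mem hy (add_mem (AddSubmonoid.subset_closure hd') hy'),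
      by rw [h', h]; abel⟩⟩
  have : Std.Irrefl r := ⟨by
    rintro a ⟨d, hd, y, hy, h⟩
    exact add_ne_zero_of_mem_closure hΦ hP hd hy (left_eq_add.1 h)⟩
  have key (b : P) : b.1 ∈ AddSubmonoid.closure (simpleRoots P) := by
    induction b using (Finite.wellFounded_of_trans_of_irrefl r).induction with
    | _ b ih =>
    by_cases hb : ∃ β ∈ P, ∃ γ ∈ P, b.1 = β + γ
    · obtain ⟨β, hβ, γ, hγ, h⟩ := hb
      rw [h]
      exact add_mem (ih ⟨β, hβ⟩ ⟨γ, hγ, 0, zero_mem _, by rw [h, add_zero]⟩)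
        (ih ⟨γ, hγ⟩ ⟨β, hβ, 0, zero_mem _, by rw [h, add_zero, add_comm]⟩)
    · exact AddSubmonoid.subset_closure ⟨b.2, hb⟩
  exact key ⟨β, hβ⟩

lemma inner_nonneg_of_dominant (hΦ : IsRootSystem Φ) (hP : IsPositiveSystem Φ P) {v : V}
    (hv : ∀ α ∈ simpleRoots P, 0 ≤ pair v α) {β : V} (hβ : β ∈ P) : 0 ≤ ⟪v, β⟫ := by
  have h := mem_closure_simpleRoots hΦ hP hβ
  clear hβ
  induction h using AddSubmonoid.closure_induction with
  | mem α hα => exact (pair_nonneg_iff (root_ne_zero hΦ (hP.1 hα.1))).1 (hv α hα)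
  | zero => simp
  | add x y _ _ hx hy =>
    rw [inner_add_right]
    exact add_nonneg hx hy

lemma inner_pos_of_strictly_dominant (hΦ : IsRootSystem Φ) (hP : IsPositiveSystem Φ P) {v : V}
    (hv : ∀ α ∈ simpleRoots P, 0 < pair v α) {β : V} (hβ : β ∈ P) : 0 < ⟪v, β⟫ := by
  have h := mem_closure_simpleRoots hΦ hP hβ
  refine Or.resolve_left (a := β = 0) ?_ (root_ne_zero hΦ (hP.1 hβ))
  clear hβ
  induction h using AddSubmonoid.closure_induction with
  | mem α hα => exact Or.inr ((pair_pos_iff (root_ne_zero hΦ (hP.1 hα.1))).1 (hv α hα))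
  | zero => exact Or.inl rfl
  | add x y _ _ hx hy =>
    rcases hx with rfl | hx
    · simpa using hy
    rcases hy with rfl | hy
    · simpa using Or.inr hx
    · exact Or.inr (by rw [inner_add_right]; exact add_pos hx hy)

lemma sub_simple_mem (hΦ : IsRootSystem Φ) (hP : IsPositiveSystem Φ P) {α β : V}
    (hα : α ∈ simpleRoots P) (hβ : β ∈ P) (hne : β ≠ α) (hpos : 0 < pair β α) : β - α ∈ P := by
  have hα0 := root_ne_zero hΦ (hP.1 hα.1)
  have hroot := sub_mem_root hΦ (hP.1 hβ) (hP.1 hα.1) ((pair_pos_iff hα0).1 hpos) hne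
  by_contra hcon
  have h := neg_mem_of_notMem hP hroot hcon
  exact hα.2 ⟨β, hβ, _, h, by abel⟩

lemma add_ne_smul_simple (hΦ : IsRootSystem Φ) (hP : IsPositiveSystem Φ P) {α : V}
    (hα : α ∈ simpleRoots P) (k : ℕ) : ∀ β ∈ P, ∀ γ ∈ P, β ≠ α → pair β α = k →
      β + γ ≠ (k : ℝ) • α := by
  have hα0 := root_ne_zero hΦ (hP.1 hα.1)
  induction k using Nat.strong_induction_on with
  | _ k ih =>
  intro β hβ γ hγ hne hk h
  rcases lt_trichotomy k 1 with h1 | rfl | h1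
  · obtain rfl : k = 0 := by omega
    rw [Nat.cast_zero, zero_smul] at h
    exact neg_notMem_of_mem hP hβ (eq_neg_of_add_eq_zero_right h ▸ hγ)
  · exact hα.2 ⟨β, hβ, γ, hγ, by rw [h]; simp⟩
  · have hk0 : (0 : ℝ) < k := by exact_mod_cast (by omega : 0 < k)
    have hγk : pair γ α = k := by
      rw [eq_sub_of_add_eq' h, pair_sub_left, pair_smul_left, pair_self hα0, hk]
      ring
    have hγne : γ ≠ α := by
      rintro rfl
      have h2 : β = ((k : ℝ) - 1) • γ := by rw [sub_smul, one_smul, ← h]; abel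
      rcases hΦ.reduced γ (hP.1 hγ) _ (h2 ▸ hP.1 hβ) with h3 | h3
      · exact hne (by rw [h2, h3, one_smul])
      · linarith
    have h2ne : β - α ≠ α := by
      intro h2
      have h3 : β = (2 : ℝ) • α := by rw [two_smul, ← eq_add_of_sub_eq h2]
      rcases hΦ.reduced α (hP.1 hα.1) 2 (h3 ▸ hP.1 hβ) with h4 | h4 <;> norm_num at h4
    have hcast : ((k - 2 : ℕ) : ℝ) = k - 2 := by
      rw [Nat.cast_sub (by omega)]
      norm_num
    refine ih (k - 2) (by omega) (β - α) (sub_simple_mem hΦ hP hα hβ hne (hk ▸ hk0))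
      (γ - α) (sub_simple_mem hΦ hP hα hγ hγne (hγk ▸ hk0)) h2ne ?_ ?_
    · rw [pair_sub_left, pair_self hα0, hk, hcast]
    · rw [hcast, sub_smul, ← h]
      module

lemma refl_simple_mem (hΦ : IsRootSystem Φ) (hP : IsPositiveSystem Φ P) {α β : V}
    (hα : α ∈ simpleRoots P) (hβ : β ∈ P) (hne : β ≠ α) : refl α β ∈ P := by
  by_contra hcon
  have h := neg_mem_of_notMem hP (refl_mem_root hΦ (hP.1 hα.1) (hP.1 hβ)) hcon
  obtain ⟨k, hk⟩ := hΦ.crystallographic α (hP.1 hα.1) β (hP.1 hβ)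
  have hsum : β + -refl α β = (k : ℝ) • α := by
    rw [refl_apply, hk]
    abel
  obtain ⟨n, rfl | rfl⟩ := k.eq_nat_or_neg
  · exact add_ne_smul_simple hΦ hP hα n β hβ _ h hne (by simpa using hk) (by simpa using hsum)
  · refine add_ne_zero_of_mem_closure hΦ hP hβ (y := -refl α β + n • α)
      (add_mem (AddSubmonoid.subset_closure h)
        (nsmul_mem (AddSubmonoid.subset_closure hα.1) n)) ?_
    rw [← add_assoc, hsum, ← Nat.cast_smul_eq_nsmul ℝ]
    simp

lemma refl_simple_rho (hΦ : IsRootSystem Φ) (hP : IsPositiveSystem Φ P) {α : V}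
    (hα : α ∈ simpleRoots P) : refl α (rho P) = rho P - α := by
  classical
  have hfin : P.Finite := hΦ.finite.subset hP.1
  have hα0 := root_ne_zero hΦ (hP.1 hα.1)
  have hmem : α ∈ hfin.toFinset := by simpa using hα.1
  have hrho : rho P = (2 : ℝ)⁻¹ • (α + ∑ β ∈ hfin.toFinset.erase α, β) := by
    rw [rho, finsum_mem_eq_finite_toFinset_sum _ hfin, Finset.add_sum_erase _ (fun β => β) hmem]
  have hmaps : ∀ β ∈ hfin.toFinset.erase α, refl α β ∈ hfin.toFinset.erase α := by
    intro β hβ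
    simp only [Finset.mem_erase, Set.Finite.mem_toFinset] at hβ ⊢
    refine ⟨fun h => ?_, refl_simple_mem hΦ hP hα hβ.2 hβ.1⟩
    have h2 : β = -α := by rw [← refl_refl α β, h, refl_self hα0]
    exact neg_notMem_of_mem hP hα.1 (h2 ▸ hβ.2)
  have hperm : ∑ β ∈ hfin.toFinset.erase α, refl α β = ∑ β ∈ hfin.toFinset.erase α, β :=
    Finset.sum_bij' (fun β _ => refl α β) (fun β _ => refl α β) hmaps hmaps
      (fun β _ => refl_refl α β) (fun β _ => refl_refl α β) (fun _ _ => rfl)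
  rw [hrho, map_smul, map_add, map_sum, hperm, refl_self hα0]
  module

lemma pair_rho_simple (hΦ : IsRootSystem Φ) (hP : IsPositiveSystem Φ P) {α : V}
    (hα : α ∈ simpleRoots P) : pair (rho P) α = 1 := by
  have h := refl_simple_rho hΦ hP hα
  rw [refl_apply, sub_right_inj] at h
  exact smul_left_injective ℝ (root_ne_zero hΦ (hP.1 hα.1)) (by simpa using h)

lemma inner_rho_pos (hΦ : IsRootSystem Φ) (hP : IsPositiveSystem Φ P) {β : V} (hβ : β ∈ P) :
    0 < ⟪rho P, β⟫ :=
  inner_pos_of_strictly_dominant hΦ hP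
    (fun α hα => by rw [pair_rho_simple hΦ hP hα]; exact one_pos) hβ

end positive

section simpleReflections

/-- The group generated by the simple reflections is the Weyl group. -/
lemma weylGroup_eq_closure_simple (hΦ : IsRootSystem Φ) (hP : IsPositiveSystem Φ P) :
    weylGroup Φ = Subgroup.closure (refl '' simpleRoots P) := by
  have hle : Subgroup.closure (refl '' simpleRoots P) ≤ weylGroup Φ := by
    rw [Subgroup.closure_le]
    rintro _ ⟨α, hα, rfl⟩
    exact refl_mem_weylGroup (hP.1 hα.1)
  refine le_antisymm ?_ hle
  have key : ∀ β ∈ P, refl β ∈ Subgroup.closure (refl '' simpleRoots P) := by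
    intro β hβ
    let O : Set V := {γ ∈ P | ∃ w ∈ Subgroup.closure (refl '' simpleRoots P), w γ = β}
    have hO : O.Finite := (hΦ.finite.subset hP.1).subset fun _ h => h.1
    obtain ⟨γ, ⟨hγP, w, hw, hwγ⟩, hmin⟩ :=
      hO.exists_minimalFor (fun γ => ⟪rho P, γ⟫) O ⟨β, hβ, 1, one_mem _, rfl⟩
    have hγ : γ ∈ simpleRoots P := by
      by_contra hns
      have hex : ∃ α ∈ simpleRoots P, 0 < pair γ α := by
        by_contra! hcon
        have := inner_nonneg_of_dominant hΦ hP (v := -γ) (fun α hα => by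
          have h := hcon α hα
          have h2 := pair_smul_left (-1) γ α
          rw [neg_one_smul] at h2
          linarith) hγP
        rw [inner_neg_left] at this
        linarith [inner_self_pos_of_ne_zero (root_ne_zero hΦ (hP.1 hγP))]
      obtain ⟨α, hα, hpos⟩ := hex
      have hmem : refl α γ ∈ O := by
        refine ⟨refl_simple_mem hΦ hP hα hγP (fun h => hns (h ▸ hα)), w * refl α,
          mul_mem hw (Subgroup.subset_closure ⟨α, hα, rfl⟩), ?_⟩
        rw [LinearEquiv.mul_apply, refl_refl, hwγ]
      have hle2 : ⟪rho P, refl α γ⟫ ≤ ⟪rho P, γ⟫ := by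
        rw [refl_apply, inner_sub_right, real_inner_smul_right]
        nlinarith [inner_rho_pos hΦ hP hα.1]
      have h3 := hmin hmem hle2
      simp only [refl_apply, inner_sub_right, real_inner_smul_right] at h3
      nlinarith [mul_pos hpos (inner_rho_pos hΦ hP hα.1)]
    rw [← hwγ, refl_weyl (hle hw)]
    exact mul_mem (mul_mem hw (Subgroup.subset_closure ⟨γ, hγ, rfl⟩)) (inv_mem hw)
  rw [weylGroup, Subgroup.closure_le]
  rintro s ⟨β, hβ, hs⟩
  rw [eq_refl_of_forall hs]
  by_cases h : β ∈ P
  · exact key β h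
  · have h1 := key _ (neg_mem_of_notMem hP hβ h)
    have h2 : refl (-β) = refl β := LinearEquiv.ext fun v => by
      simp only [refl_apply, pair, inner_neg_right, inner_neg_left, neg_neg]
      module
    rwa [h2] at h1

lemma exists_mem_pow (hΦ : IsRootSystem Φ) (hP : IsPositiveSystem Φ P) {w : V ≃ₗ[ℝ] V}
    (hw : w ∈ weylGroup Φ) : ∃ n : ℕ, w ∈ (refl '' simpleRoots P) ^ n := by
  rw [weylGroup_eq_closure_simple hΦ hP] at hw
  induction hw using Subgroup.closure_induction'' with
  | mem x hx => exact ⟨1, by simpa using hx⟩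
  | inv_mem x hx =>
    obtain ⟨α, hα, rfl⟩ := hx
    exact ⟨1, by rw [refl_inv]; simpa using ⟨α, hα, rfl⟩⟩
  | one => exact ⟨0, by simp⟩
  | mul x y _ _ hx hy =>
    obtain ⟨m, hm⟩ := hx
    obtain ⟨n, hn⟩ := hy
    exact ⟨m + n, by rw [pow_add]; exact Set.mul_mem_mul hm hn⟩

lemma mem_weylGroup_of_mem_pow (hP : IsPositiveSystem Φ P) {n : ℕ} {w : V ≃ₗ[ℝ] V}
    (hw : w ∈ (refl '' simpleRoots P) ^ n) : w ∈ weylGroup Φ := by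
  induction n generalizing w with
  | zero =>
    rw [pow_zero, Set.mem_one] at hw
    exact hw ▸ one_mem _
  | succ n ih =>
    rw [pow_succ] at hw
    obtain ⟨u, hu, _, ⟨α, hα, rfl⟩, rfl⟩ := hw
    exact mul_mem (ih hu) (refl_mem_weylGroup (hP.1 hα.1))

/-- The exchange condition. -/
lemma exists_mul_refl_mem_pow (hΦ : IsRootSystem Φ) (hP : IsPositiveSystem Φ P) {α : V}
    (hα : α ∈ simpleRoots P) {n : ℕ} {w : V ≃ₗ[ℝ] V} (hw : w ∈ (refl '' simpleRoots P) ^ n)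
    (hneg : w α ∉ P) : ∃ m < n, w * refl α ∈ (refl '' simpleRoots P) ^ m := by
  induction n generalizing w with
  | zero =>
    rw [pow_zero, Set.mem_one] at hw
    subst hw
    exact absurd hα.1 hneg
  | succ n ih =>
    rw [pow_succ'] at hw
    obtain ⟨_, ⟨β, hβ, rfl⟩, u, hu, rfl⟩ := hw
    by_cases huα : u α ∈ P
    · have hβu : u α = β := by
        by_contra hne
        exact hneg (refl_simple_mem hΦ hP hβ huα hne)
      refine ⟨n, n.lt_succ_self, ?_⟩
      have h : refl β * u * refl α = u := by
        rw [← hβu, refl_weyl (mem_weylGroup_of_mem_pow hP hu)]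
        simp [mul_assoc, refl_mul_self]
      simpa only [h] using hu
    · obtain ⟨m, hm, hmem⟩ := ih hu huα
      refine ⟨m + 1, by omega, ?_⟩
      rw [pow_succ']
      exact ⟨refl β, ⟨β, hβ, rfl⟩, _, hmem, (mul_assoc _ _ _).symm⟩

/-- The closed dominant chamber is a strict fundamental domain, and the Weyl group acts freely on
the orbit of a strictly dominant vector. -/
lemma weyl_apply_eq_self (hΦ : IsRootSystem Φ) (hP : IsPositiveSystem Φ P) {w : V ≃ₗ[ℝ] V}
    (hw : w ∈ weylGroup Φ) {v : V} (hv : ∀ α ∈ simpleRoots P, 0 ≤ pair v α)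
    (hwv : ∀ α ∈ simpleRoots P, 0 ≤ pair (w v) α) :
    w v = v ∧ ((∀ α ∈ simpleRoots P, 0 < pair v α) → w = 1) := by
  obtain ⟨n, hn⟩ := exists_mem_pow hΦ hP hw
  induction n using Nat.strong_induction_on generalizing w with
  | _ n ih =>
  rcases n with _ | n
  · rw [pow_zero, Set.mem_one] at hn
    subst hn
    exact ⟨rfl, fun _ => rfl⟩
  rw [pow_succ] at hn
  obtain ⟨u, hu, _, ⟨α, hα, rfl⟩, rfl⟩ := hn
  have hu' := mem_weylGroup_of_mem_pow hP hu
  have hα0 := root_ne_zero hΦ (hP.1 hα.1)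
  have hwα : (u * refl α) α = -u α := by
    rw [LinearEquiv.mul_apply, refl_self hα0, map_neg]
  by_cases huα : u α ∈ P
  · have h1 := inner_nonneg_of_dominant hΦ hP hwv huα
    have h2 : ⟪(u * refl α) v, u α⟫ = -⟪v, α⟫ := by
      rw [← neg_neg (u α), ← hwα, inner_neg_right, inner_weyl hw]
    have h3 : pair v α = 0 := by
      refine le_antisymm (not_lt.1 fun h => ?_) (hv α hα)
      linarith [(pair_pos_iff hα0).1 h]
    have h4 : (u * refl α) v = u v := by rw [LinearEquiv.mul_apply, refl_eq_self h3]
    rw [h4] at hwv ⊢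
    exact ⟨(ih n n.lt_succ_self hu' hwv hu).1, fun h => absurd h3 (h α hα).ne'⟩
  · obtain ⟨m, hm, hmem⟩ := exists_mul_refl_mem_pow hΦ hP hα hu huα
    exact ih m (by omega) hw hwv hmem

lemma dominant_of_forall_inner_rho_le (hΦ : IsRootSystem Φ) (hP : IsPositiveSystem Φ P) {v : V}
    (h : ∀ w ∈ weylGroup Φ, ⟪rho P, w v⟫ ≤ ⟪rho P, v⟫) : ∀ α ∈ simpleRoots P, 0 ≤ pair v α := by
  intro α hα
  have h1 := h _ (refl_mem_weylGroup (hP.1 hα.1))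
  rw [refl_apply, inner_sub_right, real_inner_smul_right, sub_le_self_iff] at h1
  exact (mul_nonneg_iff_of_pos_right (inner_rho_pos hΦ hP hα.1)).1 h1

lemma exists_weyl_max (hΦ : IsRootSystem Φ) (v : V) :
    ∃ u ∈ weylGroup Φ, ∀ w ∈ weylGroup Φ, ⟪rho P, w v⟫ ≤ ⟪rho P, u v⟫ := by
  have := finite_weylGroup hΦ
  obtain ⟨u, hu⟩ := Finite.exists_max fun w : weylGroup Φ => ⟪rho P, w.1 v⟫
  exact ⟨u, u.2, fun w hw => hu ⟨w, hw⟩⟩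

lemma exists_weyl_dominant (hΦ : IsRootSystem Φ) (hP : IsPositiveSystem Φ P) (v : V) :
    ∃ u ∈ weylGroup Φ, ∀ α ∈ simpleRoots P, 0 ≤ pair (u v) α := by
  obtain ⟨u, hu, hmax⟩ := exists_weyl_max (P := P) hΦ v
  exact ⟨u, hu, dominant_of_forall_inner_rho_le hΦ hP fun w hw => hmax (w * u) (mul_mem hw hu)⟩

lemma inner_rho_weyl_lt (hΦ : IsRootSystem Φ) (hP : IsPositiveSystem Φ P) {v : V}
    (hv : ∀ α ∈ simpleRoots P, 0 ≤ pair v α) {w : V ≃ₗ[ℝ] V} (hw : w ∈ weylGroup Φ)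
    (hne : w v ≠ v) : ⟪rho P, w v⟫ < ⟪rho P, v⟫ := by
  obtain ⟨u, hu, hmax⟩ := exists_weyl_max (P := P) hΦ v
  have huv : u v = v := (weyl_apply_eq_self hΦ hP hu hv
    (dominant_of_forall_inner_rho_le hΦ hP fun w hw => hmax (w * u) (mul_mem hw hu))).1
  rw [huv] at hmax
  refine lt_of_le_of_ne (hmax w hw) fun heq => hne ?_
  refine (weyl_apply_eq_self hΦ hP hw hv (dominant_of_forall_inner_rho_le hΦ hP fun x hx => ?_)).1
  rw [heq]
  exact hmax (x * w) (mul_mem hx hw)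

lemma norm_rho_add_weyl_lt (hΦ : IsRootSystem Φ) (hP : IsPositiveSystem Φ P) {v : V}
    (hv : ∀ α ∈ simpleRoots P, 0 ≤ pair v α) {w : V ≃ₗ[ℝ] V} (hw : w ∈ weylGroup Φ)
    (hne : w v ≠ v) : ‖rho P + w v‖ < ‖rho P + v‖ := by
  have h := inner_rho_weyl_lt hΦ hP hv hw hne
  refine lt_of_pow_lt_pow_left₀ 2 (norm_nonneg _) ?_
  rw [norm_add_sq_real, norm_add_sq_real, norm_weyl hw]
  linarith

end simpleReflections
end CS

namespace CS

open scoped RealInnerProductSpace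

variable {V : Type} [NormedAddCommGroup V] [InnerProductSpace ℝ V]
variable {Φ P : Set V}

section lattice

lemma finite_lattice_norm_le (hΦ : IsRootSystem Φ) (R : ℝ) :
    {x : weightLattice Φ | ‖(x : V)‖ ≤ R}.Finite := by
  classical
  have := hΦ.finite.fintype
  let F : weightLattice Φ → Φ → ℤ := fun x α => ⌊pair (x : V) α⌋
  have hF (x : weightLattice Φ) (α : Φ) : (F x α : ℝ) = pair (x : V) α := by
    obtain ⟨k, hk⟩ := x.2 α α.2
    simp [F, hk]
  let B : Φ → ℤ := fun α => ⌈2 * (R * ‖(α : V)‖) / ⟪(α : V), α⟫⌉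
  have hinj : Function.Injective F := by
    intro x y hxy
    apply Subtype.ext
    refine ext_inner_left ℝ fun v => ?_
    have hv : v ∈ Submodule.span ℝ Φ := hΦ.span_top ▸ Submodule.mem_top
    induction hv using Submodule.span_induction with
    | mem α hα =>
      have h : pair (x : V) α = pair (y : V) α := by
        rw [← hF x ⟨α, hα⟩, ← hF y ⟨α, hα⟩, hxy]
      have hx := pair_mul_inner_self (x : V) α
      have hy := pair_mul_inner_self (y : V) α
      rw [real_inner_comm, real_inner_comm (y : V)]
      rw [h] at hx
      linarith
    | zero => simp
    | add a b _ _ ha hb => rw [inner_add_left, inner_add_left, ha, hb]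
    | smul c a _ ha => rw [real_inner_smul_left, real_inner_smul_left, ha]
  refine Set.Finite.of_finite_image ((Set.finite_Icc (-B) B).subset ?_) hinj.injOn
  rintro _ ⟨x, hx, rfl⟩
  have hbound (α : Φ) : |pair (x : V) α| ≤ B α := by
    refine le_trans ?_ (Int.le_ceil _)
    have hpos := inner_self_pos_of_ne_zero (root_ne_zero hΦ α.2)
    rw [pair, abs_div, abs_mul, abs_two, abs_of_pos hpos]
    gcongr
    exact (abs_real_inner_le_norm _ _).trans (by gcongr; exact hx)
  constructor <;> intro α
  · have := (abs_le.1 (hbound α)).1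
    rw [← hF] at this
    exact_mod_cast this
  · have := (abs_le.1 (hbound α)).2
    rw [← hF] at this
    exact_mod_cast this

lemma lattice_norm_induction (hΦ : IsRootSystem Φ) {p : weightLattice Φ → Prop}
    (h : ∀ x : weightLattice Φ,
      (∀ y : weightLattice Φ, ‖(y : V)‖ < ‖(x : V)‖ → p y) → p x) (x : weightLattice Φ) :
    p x := by
  have hfin (x : weightLattice Φ) : {y : weightLattice Φ | ‖(y : V)‖ < ‖(x : V)‖}.Finite :=
    (finite_lattice_norm_le hΦ ‖(x : V)‖).subset
      fun y (hy : ‖(y : V)‖ < ‖(x : V)‖) => hy.le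
  induction hn : {y : weightLattice Φ | ‖(y : V)‖ < ‖(x : V)‖}.ncard
    using Nat.strong_induction_on generalizing x with
  | _ n ih =>
  refine h x fun y hy => ih _ ?_ y rfl
  rw [← hn]
  refine Set.ncard_lt_ncard ⟨fun z hz => lt_trans hz hy, fun hsub => ?_⟩ (hfin x)
  exact lt_irrefl ‖(y : V)‖ (hsub hy)

end lattice

section groupAlgebra

variable [FiniteDimensional ℝ V]

lemma sgn_mul (u w : V ≃ₗ[ℝ] V) : sgn (u * w) = sgn u * sgn w := by
  have h : ((u * w : V ≃ₗ[ℝ] V) : V →ₗ[ℝ] V) = (u : V →ₗ[ℝ] V) * (w : V →ₗ[ℝ] V) := rfl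
  rw [sgn, h, map_mul, Complex.ofReal_mul, sgn, sgn]

lemma sgn_one : sgn (1 : V ≃ₗ[ℝ] V) = 1 := by
  have h : ((1 : V ≃ₗ[ℝ] V) : V →ₗ[ℝ] V) = 1 := rfl
  rw [sgn, h, map_one, Complex.ofReal_one]

lemma sgn_mul_sgn_inv (u : V ≃ₗ[ℝ] V) : sgn u * sgn u⁻¹ = 1 := by
  rw [← sgn_mul, mul_inv_cancel, sgn_one]

lemma act_e (hΦ : IsRootSystem Φ) {w : V ≃ₗ[ℝ] V} (hw : w ∈ weylGroup Φ) (μ : weightLattice Φ) :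
    act hΦ hw (e μ) = e (latHom hΦ hw μ) :=
  AddMonoidAlgebra.mapDomain_single

lemma single_eq_smul_e (μ : weightLattice Φ) (r : ℂ) :
    (AddMonoidAlgebra.single μ r : GA Φ) = r • e μ := by
  simp [e]

lemma e_add (μ ν : weightLattice Φ) : e (μ + ν) = e μ * e ν := by
  simp [e, AddMonoidAlgebra.single_mul_single]

lemma act_act (hΦ : IsRootSystem Φ) {u w : V ≃ₗ[ℝ] V} (hu : u ∈ weylGroup Φ)
    (hw : w ∈ weylGroup Φ) (f : GA Φ) :
    act hΦ hu (act hΦ hw f) = act hΦ (mul_mem hu hw) f := by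
  induction f using AddMonoidAlgebra.induction_linear with
  | zero => simp
  | add x y hx hy => rw [map_add, map_add, map_add, hx, hy]
  | single μ r =>
    rw [single_eq_smul_e, map_smul, map_smul, map_smul, act_e, act_e, act_e]
    rfl

lemma alt_eq_sum [Fintype (weylGroup Φ)] (hΦ : IsRootSystem Φ) (f : GA Φ) :
    alt hΦ f = ∑ w : weylGroup Φ, sgn (w : V ≃ₗ[ℝ] V) • act hΦ w.2 f :=
  finsum_eq_sum_of_fintype _

/-- The alternating map as a linear map. -/
def altLinear (hΦ : IsRootSystem Φ) : GA Φ →ₗ[ℂ] GA Φ where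
  toFun := alt hΦ
  map_add' f g := by
    have := finite_weylGroup hΦ
    have := Fintype.ofFinite (weylGroup Φ)
    simp only [alt_eq_sum, map_add, smul_add, Finset.sum_add_distrib]
  map_smul' c f := by
    have := finite_weylGroup hΦ
    have := Fintype.ofFinite (weylGroup Φ)
    simp only [alt_eq_sum, map_smul, Finset.smul_sum, RingHom.id_apply, smul_comm c]

lemma alt_act (hΦ : IsRootSystem Φ) {u : V ≃ₗ[ℝ] V} (hu : u ∈ weylGroup Φ) (f : GA Φ) :
    alt hΦ (act hΦ hu f) = sgn u⁻¹ • alt hΦ f := by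
  have := finite_weylGroup hΦ
  have := Fintype.ofFinite (weylGroup Φ)
  rw [alt_eq_sum, alt_eq_sum, Finset.smul_sum]
  refine Fintype.sum_equiv (Equiv.mulRight ⟨u, hu⟩) _ _ fun w => ?_
  have h : sgn u⁻¹ * sgn (w.1 * u) = sgn w.1 := by
    rw [sgn_mul, mul_comm, mul_assoc, sgn_mul_sgn_inv, mul_one]
  rw [act_act, smul_smul]
  exact congrArg (· • act hΦ (mul_mem w.2 hu) f) h.symm

lemma alt_e_latHom (hΦ : IsRootSystem Φ) {u : V ≃ₗ[ℝ] V} (hu : u ∈ weylGroup Φ)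
    (μ : weightLattice Φ) : alt hΦ (e (latHom hΦ hu μ)) = sgn u⁻¹ • alt hΦ (e μ) := by
  rw [← act_e, alt_act]

lemma alt_e_eq_zero (hΦ : IsRootSystem Φ) {α : V} (hα : α ∈ Φ) {μ : weightLattice Φ}
    (h : pair (μ : V) α = 0) : alt hΦ (e μ) = 0 := by
  have h1 := alt_e_latHom hΦ (refl_mem_weylGroup hα) μ
  have h2 : latHom hΦ (refl_mem_weylGroup hα) μ = μ := Subtype.ext (refl_eq_self h)
  rw [h2, refl_inv, sgn_refl (root_ne_zero hΦ hα), neg_one_smul] at h1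
  have h3 : (2 : ℂ) • alt hΦ (e μ) = 0 := by rw [two_smul, ← eq_neg_iff_add_eq_zero, ← h1]
  exact (smul_eq_zero.1 h3).resolve_left two_ne_zero

lemma alt_mul_of_isInvariant (hΦ : IsRootSystem Φ) (f : GA Φ) {a : GA Φ}
    (ha : IsInvariant hΦ a) : alt hΦ (f * a) = alt hΦ f * a := by
  have := finite_weylGroup hΦ
  have := Fintype.ofFinite (weylGroup Φ)
  rw [alt_eq_sum, alt_eq_sum, Finset.sum_mul]
  refine Finset.sum_congr rfl fun w _ => ?_
  rw [map_mul, ha w w.2, smul_mul_assoc]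

lemma isInvariant_sum_act [Fintype (weylGroup Φ)] (hΦ : IsRootSystem Φ) (f : GA Φ) :
    IsInvariant hΦ (∑ w : weylGroup Φ, act hΦ w.2 f) := by
  intro u hu
  rw [map_sum]
  refine Fintype.sum_equiv (Equiv.mulLeft ⟨u, hu⟩) _ _ fun w => ?_
  rw [act_act]
  rfl

lemma coeff_alt_e [DecidableEq (weightLattice Φ)] (hΦ : IsRootSystem Φ)
    (hP : IsPositiveSystem Φ P) {μ ν : weightLattice Φ}
    (hμ : ∀ α ∈ simpleRoots P, 0 < pair (μ : V) α)
    (hν : ∀ α ∈ simpleRoots P, 0 < pair (ν : V) α) :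
    (alt hΦ (e μ)).coeff ν = if μ = ν then 1 else 0 := by
  have := finite_weylGroup hΦ
  have := Fintype.ofFinite (weylGroup Φ)
  have hone {w : weylGroup Φ} (h : latHom hΦ w.2 μ = ν) : μ = ν ∧ w = 1 := by
    have hw : w.1 μ = ν := congrArg Subtype.val h
    have h2 := weyl_apply_eq_self hΦ hP w.2 (fun α hα => (hμ α hα).le)
      (fun α hα => by rw [hw]; exact (hν α hα).le)
    exact ⟨Subtype.ext (h2.1.symm.trans hw), Subtype.ext (h2.2 hμ)⟩
  have hterm (w : weylGroup Φ) : (sgn (w : V ≃ₗ[ℝ] V) • act hΦ w.2 (e μ)).coeff ν =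
      if latHom hΦ w.2 μ = ν then sgn (w : V ≃ₗ[ℝ] V) else 0 := by
    rw [act_e, AddMonoidAlgebra.coeff_smul_apply, e, AddMonoidAlgebra.coeff_single, Finsupp.single_apply]
    simp
  rw [alt_eq_sum, AddMonoidAlgebra.coeff_sum, Finsupp.finsetSum_apply]
  simp only [hterm]
  rw [Finset.sum_eq_single 1]
  · have h1 : latHom hΦ (1 : weylGroup Φ).2 μ = μ := rfl
    rw [h1]
    simp [sgn_one]
  · intro w _ hw
    exact if_neg fun h => hw (hone h).2
  · simp

/-- Up to a scalar, every alternating sum `alt(e^x)` is zero or of the form `alt(e^{ν+ρ})` with `ν`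
dominant. -/
lemma alt_e_eq_zero_or_eq_smul (hΦ : IsRootSystem Φ) (hP : IsPositiveSystem Φ P)
    (hρ : rho P ∈ weightLattice Φ) (x : weightLattice Φ) :
    alt hΦ (e x) = 0 ∨ ∃ (ν : weightLattice Φ) (c : ℂ),
      (∀ α ∈ simpleRoots P, 0 ≤ pair (ν : V) α) ∧ ‖rho P + ν‖ = ‖(x : V)‖ ∧
        alt hΦ (e x) = c • alt hΦ (e (ν + ⟨rho P, hρ⟩)) := by
  obtain ⟨u, hu, hdom⟩ := exists_weyl_dominant hΦ hP (x : V)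
  have halt : alt hΦ (e x) = sgn u • alt hΦ (e (latHom hΦ hu x)) := by
    rw [alt_e_latHom, smul_smul, sgn_mul_sgn_inv, one_smul]
  by_cases hreg : ∃ α ∈ simpleRoots P, pair (u x) α = 0
  · obtain ⟨α, hα, h0⟩ := hreg
    left
    rw [halt, alt_e_eq_zero hΦ (hP.1 hα.1) h0, smul_zero]
  push Not at hreg
  refine Or.inr ⟨latHom hΦ hu x - ⟨rho P, hρ⟩, sgn u, fun α hα => ?_, ?_, ?_⟩
  · obtain ⟨k, hk⟩ := (latHom hΦ hu x).2 α (hP.1 hα.1)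
    change pair (u x) α = k at hk
    have h2 : 0 < pair (u x) α := lt_of_le_of_ne (hdom α hα) (hreg α hα).symm
    change 0 ≤ pair (u x - rho P) α
    rw [pair_sub_left, pair_rho_simple hΦ hP hα, hk, sub_nonneg]
    rw [hk] at h2
    exact_mod_cast h2
  · rw [← norm_weyl hu (x : V)]
    exact congrArg norm (add_sub_cancel (rho P) (u x))
  · rw [sub_add_cancel, halt]

/-- The alternating sums are multiples of the Weyl denominator by invariants. -/
lemma alt_e_mem_map_mulLeft (hΦ : IsRootSystem Φ) (hP : IsPositiveSystem Φ P)
    (hρ : rho P ∈ weightLattice Φ) (x : weightLattice Φ) :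
    alt hΦ (e x) ∈ (Subalgebra.toSubmodule (invSubalgebra hΦ)).map
      (LinearMap.mulLeft ℂ (alt hΦ (e ⟨rho P, hρ⟩))) := by
  classical
  have := finite_weylGroup hΦ
  have := Fintype.ofFinite (weylGroup Φ)
  induction x using lattice_norm_induction hΦ with
  | h x ih =>
  set M := (Subalgebra.toSubmodule (invSubalgebra hΦ)).map
      (LinearMap.mulLeft ℂ (alt hΦ (e ⟨rho P, hρ⟩)))
  obtain h0 | ⟨ν, c, hνdom, hnorm, halt⟩ := alt_e_eq_zero_or_eq_smul hΦ hP hρ x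
  · exact h0 ▸ M.zero_mem
  rw [halt]
  refine M.smul_mem c ?_
  have hsum : ∑ w : weylGroup Φ, alt hΦ (e (latHom hΦ w.2 ν + ⟨rho P, hρ⟩)) ∈ M := by
    refine ⟨∑ w : weylGroup Φ, act hΦ w.2 (e ν), isInvariant_sum_act hΦ (e ν), ?_⟩
    rw [LinearMap.mulLeft_apply, ← alt_mul_of_isInvariant hΦ _ (isInvariant_sum_act hΦ (e ν)),
      mul_comm, Finset.sum_mul]
    simp only [act_e, ← e_add]
    exact map_sum (altLinear hΦ) _ _
  rw [← Finset.sum_filter_add_sum_filter_not _ fun w : weylGroup Φ => latHom hΦ w.2 ν = ν] at hsum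
  have hrest : ∑ w : weylGroup Φ with ¬latHom hΦ w.2 ν = ν,
      alt hΦ (e (latHom hΦ w.2 ν + ⟨rho P, hρ⟩)) ∈ M := by
    refine M.sum_mem fun w hw => ih _ ?_
    rw [← hnorm, AddSubgroup.coe_add, add_comm]
    exact norm_rho_add_weyl_lt hΦ hP hνdom w.2
      fun h => (Finset.mem_filter.1 hw).2 (Subtype.ext h)
  have hfix := (M.add_mem_iff_left hrest).1 hsum
  rw [Finset.sum_congr rfl (g := fun _ => alt hΦ (e (ν + ⟨rho P, hρ⟩))) (fun w hw => by
    rw [(Finset.mem_filter.1 hw).2]), Finset.sum_const, ← Nat.cast_smul_eq_nsmul ℂ] at hfix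
  refine (M.smul_mem_iff ?_).1 hfix
  rw [Nat.cast_ne_zero, Finset.card_ne_zero]
  exact ⟨1, Finset.mem_filter.2 ⟨Finset.mem_univ _, rfl⟩⟩

lemma alt_mem_span (hΦ : IsRootSystem Φ) (hP : IsPositiveSystem Φ P)
    (hρ : rho P ∈ weightLattice Φ) (f : GA Φ) :
    alt hΦ f ∈ Submodule.span ℂ (Set.range
      fun lam : {x : weightLattice Φ // ∀ α ∈ simpleRoots P, 0 ≤ pair (x : V) α} =>
        alt hΦ (e (lam.1 + ⟨rho P, hρ⟩))) := by
  change altLinear hΦ f ∈ _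
  induction f using AddMonoidAlgebra.induction_linear with
  | zero =>
    rw [map_zero]
    exact Submodule.zero_mem _
  | add f g hf hg =>
    rw [map_add]
    exact Submodule.add_mem _ hf hg
  | single x r =>
    rw [single_eq_smul_e, map_smul]
    refine Submodule.smul_mem _ r ?_
    change alt hΦ (e x) ∈ _
    obtain h0 | ⟨ν, c, hν, -, halt⟩ := alt_e_eq_zero_or_eq_smul hΦ hP hρ x
    · exact h0 ▸ Submodule.zero_mem _
    · rw [halt]
      exact Submodule.smul_mem _ c (Submodule.subset_span ⟨⟨ν, hν⟩, rfl⟩)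

lemma pair_add_rho_pos (hΦ : IsRootSystem Φ) (hP : IsPositiveSystem Φ P) {v : V}
    (hv : ∀ α ∈ simpleRoots P, 0 ≤ pair v α) : ∀ α ∈ simpleRoots P, 0 < pair (v + rho P) α := by
  intro α hα
  have h := (pairForm α).map_add v (rho P)
  change pair (v + rho P) α = pair v α + pair (rho P) α at h
  rw [h, pair_rho_simple hΦ hP hα]
  linarith [hv α hα]

lemma linearIndependent_alt (hΦ : IsRootSystem Φ) (hP : IsPositiveSystem Φ P)
    (hρ : rho P ∈ weightLattice Φ) :
    LinearIndependent ℂ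
      fun lam : {x : weightLattice Φ // ∀ α ∈ simpleRoots P, 0 ≤ pair (x : V) α} =>
        alt hΦ (e (lam.1 + ⟨rho P, hρ⟩)) := by
  classical
  let T : GA Φ →ₗ[ℂ] ({x : weightLattice Φ // ∀ α ∈ simpleRoots P, 0 ≤ pair (x : V) α} → ℂ) :=
    { toFun := fun f lam => f.coeff (lam.1 + ⟨rho P, hρ⟩)
      map_add' := fun _ _ => rfl
      map_smul' := fun _ _ => rfl }
  refine LinearIndependent.of_comp T ?_
  convert Pi.linearIndependent_single_one
    {x : weightLattice Φ // ∀ α ∈ simpleRoots P, 0 ≤ pair (x : V) α} ℂ using 1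
  funext lam mu
  have h := coeff_alt_e hΦ hP (μ := lam.1 + ⟨rho P, hρ⟩) (ν := mu.1 + ⟨rho P, hρ⟩)
    (pair_add_rho_pos hΦ hP lam.2) (pair_add_rho_pos hΦ hP mu.2)
  refine h.trans ?_
  simp only [add_left_inj, Pi.single_apply, Subtype.ext_iff, eq_comm]

lemma alt_e_rho_ne_zero (hΦ : IsRootSystem Φ) (hP : IsPositiveSystem Φ P)
    (hρ : rho P ∈ weightLattice Φ) : alt hΦ (e ⟨rho P, hρ⟩) ≠ 0 := by
  have h := (linearIndependent_alt hΦ hP hρ).ne_zero ⟨0, fun α _ => by simp [pair]⟩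
  simpa using h

lemma noZeroDivisors_GA : NoZeroDivisors (GA Φ) :=
  have : TwoUniqueSums (weightLattice Φ) := TwoUniqueSums.of_injective_addHom
    (((Module.finBasis ℝ V).equivFun.toLinearMap.toAddMonoidHom.comp
      (weightLattice Φ).subtype : weightLattice Φ →+ (Fin (Module.finrank ℝ V) → ℝ)) :
        AddHom (weightLattice Φ) (Fin (Module.finrank ℝ V) → ℝ))
    ((Module.finBasis ℝ V).equivFun.injective.comp Subtype.val_injective) inferInstance
  inferInstance

end groupAlgebra

/-- For every dominant `λ` there is a unique `W`-invariant `a_λ` with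
`alt(e^ρ) · a_λ = alt(e^{λ+ρ})`, and the `a_λ` form a `ℂ`-basis of `ℂ[Λ]^W`. -/
theorem statement5 {V : Type} [NormedAddCommGroup V] [InnerProductSpace ℝ V]
    [FiniteDimensional ℝ V] (Φ : Set V) (hΦ : IsRootSystem Φ) (P : Set V) (hP : IsPositiveSystem Φ P)
    (hρ : rho P ∈ weightLattice Φ) :
    ∃ a : {x : ↥(weightLattice Φ) // ∀ α ∈ simpleRoots P, 0 ≤ pair ↑x α} → GA Φ,
      (∀ lam, (a lam ∈ invSubalgebra hΦ ∧
            alt hΦ (e ⟨rho P, hρ⟩) * a lam = alt hΦ (e (lam.1 + ⟨rho P, hρ⟩))) ∧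
          ∀ b : GA Φ, b ∈ invSubalgebra hΦ →
            alt hΦ (e ⟨rho P, hρ⟩) * b = alt hΦ (e (lam.1 + ⟨rho P, hρ⟩)) → b = a lam) ∧
        LinearIndependent ℂ a ∧
          Submodule.span ℂ (Set.range a) = Subalgebra.toSubmodule (invSubalgebra hΦ) := by
  have := noZeroDivisors_GA (Φ := Φ)
  have hΔ := alt_e_rho_ne_zero hΦ hP hρ
  choose a ha hmul using fun lam : {x : weightLattice Φ // ∀ α ∈ simpleRoots P,
    0 ≤ pair (x : V) α} => alt_e_mem_map_mulLeft hΦ hP hρ (lam.1 + ⟨rho P, hρ⟩)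
  set Δ := LinearMap.mulLeft ℂ (alt hΦ (e ⟨rho P, hρ⟩))
  have hinj : Function.Injective Δ := fun x y h => mul_left_cancel₀ hΔ h
  have hcomp : Δ ∘ a = fun lam => alt hΦ (e (lam.1 + ⟨rho P, hρ⟩)) := funext hmul
  refine ⟨a, fun lam => ⟨⟨ha lam, hmul lam⟩, fun b _ hb => hinj (hb.trans (hmul lam).symm)⟩,
    LinearIndependent.of_comp Δ (hcomp ▸ linearIndependent_alt hΦ hP hρ), le_antisymm ?_ ?_⟩
  · rw [Submodule.span_le]
    rintro _ ⟨lam, rfl⟩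
    exact ha lam
  · intro b hb
    have h := alt_mem_span hΦ hP hρ (e ⟨rho P, hρ⟩ * b)
    rw [alt_mul_of_isInvariant hΦ _ hb, ← hcomp, Set.range_comp, Submodule.span_image] at h
    obtain ⟨c, hc, hcb⟩ := h
    exact hinj hcb ▸ hc

end CS
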